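/- Let k ≥ 1 and let G be a (2k−1)-vertex-connected simple finite graph satisfying χ''(G) ≤ Δ(G) + k. Then Hadwiger's conjecture holds for the total graph T(G), i.e., χ(T(G)) ≤ η(T(G)). -/

import Mathlib

open SimpleGraph

/-- The total graph `T(G)` of a simple graph `G`: its vertices are the vertices and edges
of `G`, with two elements adjacent iff they are adjacent or incident in `G`. -/
def totalGraph {V : Type*} (G : SimpleGraph V) : SimpleGraph (V ⊕ G.edgeSet) :=
  SimpleGraph.fromRel fun x y =>
    match x, y with
    | Sum.inl u, Sum.inl v => G.Adj u v
    | Sum.inl u, Sum.inr e => u ∈ (e : Sym2 V)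
    | Sum.inr e, Sum.inl u => u ∈ (e : Sym2 V)
    | Sum.inr e, Sum.inr f => ∃ u, u ∈ (e : Sym2 V) ∧ u ∈ (f : Sym2 V)

/-- `cv`, `ce` form a total coloring of `G`: adjacent vertices get distinct colors, edges
sharing an endpoint get distinct colors, and every edge gets a color distinct from the colors
of both of its endpoints. -/
def IsTotalColoring {V : Type*} (G : SimpleGraph V) (cv : V → ℕ) (ce : Sym2 V → ℕ) : Prop :=
  (∀ ⦃u v⦄, G.Adj u v → cv u ≠ cv v) ∧
  (∀ ⦃u v w⦄, G.Adj u v → G.Adj u w → v ≠ w → ce s(u, v) ≠ ce s(u, w)) ∧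
  (∀ ⦃u v⦄, G.Adj u v → ce s(u, v) ≠ cv u ∧ ce s(u, v) ≠ cv v)

/-- The total chromatic number `χ''(G)`: the least `k` such that `G` has a total coloring
using colors `0, …, k-1`. -/
noncomputable def totalChromaticNumber {V : Type*} (G : SimpleGraph V) : ℕ :=
  sInf {k | ∃ cv ce, IsTotalColoring G cv ce ∧ (∀ v, cv v < k) ∧ ∀ e ∈ G.edgeSet, ce e < k}

/-- `H` has a minor isomorphic to `K`: there are pairwise disjoint nonempty branch sets,
one for each vertex of `K`, each inducing a connected subgraph of `H`, with an edge of `H`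
between the branch sets of any two adjacent vertices of `K`. -/
def HasMinor {W U : Type*} (H : SimpleGraph W) (K : SimpleGraph U) : Prop :=
  ∃ B : U → Set W,
    (∀ i, (B i).Nonempty) ∧
    (Pairwise fun i j => Disjoint (B i) (B j)) ∧
    (∀ i, (H.induce (B i)).Connected) ∧
    ∀ ⦃i j⦄, K.Adj i j → ∃ u ∈ B i, ∃ v ∈ B j, H.Adj u v

/-- `H` has a clique minor of order `t` (a `K_t`-minor): `t` pairwise disjoint nonempty
vertex subsets, each inducing a connected subgraph, with an edge between every pair. -/
def HasCliqueMinor {W : Type*} (H : SimpleGraph W) (t : ℕ) : Prop :=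
  ∃ B : Fin t → Set W,
    (∀ i, (B i).Nonempty) ∧
    (Pairwise fun i j => Disjoint (B i) (B j)) ∧
    (∀ i, (H.induce (B i)).Connected) ∧
    Pairwise fun i j => ∃ u ∈ B i, ∃ v ∈ B j, H.Adj u v

/-- The Hadwiger number `η(H)`: the largest `t` such that `H` has a `K_t`-minor. -/
noncomputable def hadwigerNumber {W : Type*} (H : SimpleGraph W) : ℕ :=
  sSup {t | HasCliqueMinor H t}

/-- A graph is `c`-vertex-connected if it has more than `c` vertices and deleting any set of
fewer than `c` vertices leaves a connected graph. -/
def IsKConnected {V : Type*} [Fintype V] (c : ℕ) (G : SimpleGraph V) : Prop :=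
  c < Fintype.card V ∧
    ∀ S : Finset V, S.card < c → (G.induce ((S : Set V)ᶜ)).Connected

/-- `G` is planar (Wagner's characterization): `G` has neither a `K₅`-minor nor a
`K₃,₃`-minor. -/
def IsPlanar {V : Type*} (G : SimpleGraph V) : Prop :=
  ¬ HasMinor G (⊤ : SimpleGraph (Fin 5)) ∧
  ¬ HasMinor G (completeBipartiteGraph (Fin 3) (Fin 3))

/-- `c` is a proper edge coloring of `G`: edges sharing an endpoint get distinct colors. -/
def IsProperEdgeColoring {V : Type*} (G : SimpleGraph V) (c : Sym2 V → ℕ) : Prop :=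
  ∀ ⦃u v w⦄, G.Adj u v → G.Adj u w → v ≠ w → c s(u, v) ≠ c s(u, w)

/-- The chromatic index `χ'(G)`: the least `k` such that `G` has a proper edge coloring
using colors `0, …, k-1`. -/
noncomputable def chromaticIndex {V : Type*} (G : SimpleGraph V) : ℕ :=
  sInf {k | ∃ c : Sym2 V → ℕ, IsProperEdgeColoring G c ∧ ∀ e ∈ G.edgeSet, c e < k}

/-- `G` is `k`-edge-choosable: for every assignment of a list of `k` colors to each edge
there is a proper edge coloring choosing each edge's color from its list. -/
def EdgeChoosable {V : Type*} (G : SimpleGraph V) (k : ℕ) : Prop :=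
  ∀ L : Sym2 V → Finset ℕ, (∀ e ∈ G.edgeSet, (L e).card = k) →
    ∃ c : Sym2 V → ℕ, IsProperEdgeColoring G c ∧ ∀ e ∈ G.edgeSet, c e ∈ L e

/-- The edge choosability `ch'(G)`: the least `k` such that `G` is `k`-edge-choosable. -/
noncomputable def edgeChoosability {V : Type*} (G : SimpleGraph V) : ℕ :=
  sInf {k | EdgeChoosable G k}

/-- The subdivision of `H`: every edge `uv` is replaced by a path `u – w_{uv} – v` through
a new vertex `w_{uv}` corresponding to that edge. -/
def subdivision {V : Type*} (H : SimpleGraph V) : SimpleGraph (V ⊕ H.edgeSet) :=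
  SimpleGraph.fromRel fun x y =>
    match x, y with
    | Sum.inl u, Sum.inr e => u ∈ (e : Sym2 V)
    | _, _ => False

/-- The square `G²` of `G`: two distinct vertices are adjacent iff their distance in `G`
is at most `2`, i.e. they are adjacent or have a common neighbour. -/
def squareGraph {V : Type*} (G : SimpleGraph V) : SimpleGraph V :=
  SimpleGraph.fromRel fun u v => G.Adj u v ∨ ∃ w, G.Adj u w ∧ G.Adj w v

namespace SimpleGraph

section Packing

variable {W : Type*}

lemma Reachable.of_forall_adj {G H : SimpleGraph W} (h : ∀ u v, G.Adj u v → H.Reachable u v)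
    {u v : W} (huv : G.Reachable u v) : H.Reachable u v := by
  obtain ⟨p⟩ := huv
  induction p with
  | nil => rfl
  | cons hadj _ ih => exact (h _ _ hadj).trans ih

/-- If reachability in `G` implies reachability in `H`, this is the induced map on components. -/
def componentMap {G H : SimpleGraph W} (h : ∀ u v, G.Reachable u v → H.Reachable u v) :
    G.ConnectedComponent → H.ConnectedComponent :=
  Quot.map id h

lemma componentMap_surjective {G H : SimpleGraph W}
    (h : ∀ u v, G.Reachable u v → H.Reachable u v) : Function.Surjective (componentMap h) := by
  rintro ⟨v⟩
  exact ⟨G.connectedComponentMk v, rfl⟩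

lemma card_connectedComponent_le [Finite W] {G H : SimpleGraph W}
    (h : ∀ u v, G.Reachable u v → H.Reachable u v) :
    Nat.card H.ConnectedComponent ≤ Nat.card G.ConnectedComponent :=
  Nat.card_le_card_of_surjective _ (componentMap_surjective h)

lemma Reachable.of_card_connectedComponent_le [Finite W] {G H : SimpleGraph W}
    (h : ∀ u v, G.Reachable u v → H.Reachable u v)
    (hcard : Nat.card G.ConnectedComponent ≤ Nat.card H.ConnectedComponent)
    {u v : W} (huv : H.Reachable u v) : G.Reachable u v := by
  have hinj : Function.Injective (componentMap h) :=
    ((componentMap_surjective h).bijective_of_nat_card_le hcard).injective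
  exact ConnectedComponent.exact (@hinj (G.connectedComponentMk u) (G.connectedComponentMk v)
    (ConnectedComponent.sound huv))

/-- Deleting a set of bridges creates at least one new component per bridge. -/
lemma card_add_card_connectedComponent_le [Finite W] (G : SimpleGraph W) (D : Finset (Sym2 W))
    (hD : ∀ e ∈ D, e ∈ G.edgeSet ∧ G.IsBridge e) :
    D.card + Nat.card G.ConnectedComponent ≤
      Nat.card (G.deleteEdges (D : Set (Sym2 W))).ConnectedComponent := by
  classical
  induction D using Finset.induction_on with
  | empty => simp
  | insert e D he ih =>
    have ih := ih fun f hf => hD f (Finset.mem_insert_of_mem hf)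
    rw [Finset.card_insert_of_notMem he]
    have hle : G.deleteEdges ((insert e D : Finset (Sym2 W)) : Set (Sym2 W)) ≤
        G.deleteEdges (D : Set (Sym2 W)) := G.deleteEdges_anti (by simp)
    by_contra! hlt
    obtain ⟨heG, hbr⟩ := hD e (Finset.mem_insert_self _ _)
    induction e with
    | h x y =>
      have hadj : (G.deleteEdges (D : Set (Sym2 W))).Adj x y := by
        rw [deleteEdges_adj]; exact ⟨heG, by simpa using he⟩
      have hr := Reachable.of_card_connectedComponent_le (fun u v h => h.mono hle) (by omega)
        hadj.reachable
      exact isBridge_iff.1 hbr (hr.mono (G.deleteEdges_anti (by simp)))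

variable {ι : Type*}

/-- The edges of `G` with color `i`. -/
def colorClass (G : SimpleGraph W) (c : Sym2 W → ι) (i : ι) : SimpleGraph W where
  Adj x y := G.Adj x y ∧ c s(x, y) = i
  symm := ⟨fun _ _ h => ⟨h.1.symm, Sym2.eq_swap ▸ h.2⟩⟩
  loopless := ⟨fun _ h => h.1.ne rfl⟩

/-- An edge is surplus for a coloring if it is not a bridge of its color class. -/
def IsSurplus (G : SimpleGraph W) (c : Sym2 W → ι) (e : Sym2 W) : Prop :=
  e ∈ G.edgeSet ∧ ¬ (colorClass G c (c e)).IsBridge e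

open Classical in
/-- Recoloring a surplus edge. -/
inductive Recolor (G : SimpleGraph W) (c : Sym2 W → ι) : (Sym2 W → ι) → Prop
  | update (e : Sym2 W) (j : ι) (h : IsSurplus G c e) : Recolor G c (Function.update c e j)

/-- The edges that are surplus after some sequence of recolorings. -/
def surplusGraph (G : SimpleGraph W) (c₀ : Sym2 W → ι) : SimpleGraph W where
  Adj x y := ∃ c, Relation.ReflTransGen (Recolor G) c₀ c ∧ IsSurplus G c s(x, y)
  symm := ⟨fun _ _ ⟨c, h, h'⟩ => ⟨c, h, Sym2.eq_swap ▸ h'⟩⟩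
  loopless := ⟨fun _ ⟨_, _, h⟩ => G.loopless.1 _ h.1⟩

/-- The total number of components of the color classes. -/
noncomputable def colorPotential [Fintype ι] (G : SimpleGraph W) (c : Sym2 W → ι) : ℕ :=
  ∑ i, Nat.card (colorClass G c i).ConnectedComponent

/-- A coloring minimizing the total number of components of the color classes. -/
def IsOptimalColoring [Fintype ι] (G : SimpleGraph W) (c : Sym2 W → ι) : Prop :=
  ∀ c' : Sym2 W → ι, colorPotential G c ≤ colorPotential G c'

lemma Recolor.reachable {G : SimpleGraph W} {c c' : Sym2 W → ι} (h : Recolor G c c') (i : ι)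
    {u v : W} (huv : (colorClass G c i).Reachable u v) : (colorClass G c' i).Reachable u v := by
  classical
  obtain ⟨e, j, he⟩ := h
  by_cases hj : j = c e
  · subst hj
    rwa [show Function.update c e (c e) = c from Function.update_eq_self e c]
  refine huv.of_forall_adj fun a b hab => ?_
  by_cases hae : s(a, b) = e
  · subst hae
    have hi : c s(a, b) = i := hab.2
    subst hi
    refine (not_not.1 (mt isBridge_iff.2 he.2)).mono fun p q hpq => ?_
    rw [deleteEdges_adj] at hpq
    refine ⟨hpq.1.1, ?_⟩
    rw [Function.update_of_ne (by simpa using hpq.2)]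
    exact hpq.1.2
  · exact Adj.reachable ⟨hab.1, by rw [Function.update_of_ne hae]; exact hab.2⟩

section Fintype

variable [Fintype ι] [Finite W] {G : SimpleGraph W} {c c' c₀ : Sym2 W → ι}

lemma IsOptimalColoring.card_eq (hc : IsOptimalColoring G c) (h : Recolor G c c') (i : ι) :
    Nat.card (colorClass G c' i).ConnectedComponent =
      Nat.card (colorClass G c i).ConnectedComponent := by
  have hle : ∀ i ∈ Finset.univ, Nat.card (colorClass G c' i).ConnectedComponent ≤
      Nat.card (colorClass G c i).ConnectedComponent := fun i _ =>
    card_connectedComponent_le fun _ _ => h.reachable i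
  exact (Finset.sum_eq_sum_iff_of_le hle).1 ((Finset.sum_le_sum hle).antisymm (hc c')) i
    (Finset.mem_univ i)

lemma IsOptimalColoring.recolor (hc : IsOptimalColoring G c) (h : Recolor G c c') :
    IsOptimalColoring G c' := by
  intro d
  refine le_trans (le_of_eq ?_) (hc d)
  exact Finset.sum_congr rfl fun i _ => hc.card_eq h i

lemma IsOptimalColoring.reachable (hc : IsOptimalColoring G c) (h : Recolor G c c') {i : ι}
    {u v : W} (huv : (colorClass G c' i).Reachable u v) : (colorClass G c i).Reachable u v :=
  huv.of_card_connectedComponent_le (fun _ _ => h.reachable i) (hc.card_eq h i).ge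

lemma IsOptimalColoring.reflTransGen (hc : IsOptimalColoring G c₀)
    (h : Relation.ReflTransGen (Recolor G) c₀ c) : IsOptimalColoring G c := by
  induction h with
  | refl => exact hc
  | tail _ h ih => exact ih.recolor h

/-- The ends of a surplus edge are joined in every color class by edges of the surplus graph. -/
lemma IsSurplus.reachable (hc₀ : IsOptimalColoring G c₀)
    (h : Relation.ReflTransGen (Recolor G) c₀ c) {x y : W} (hs : IsSurplus G c s(x, y)) (j : ι) :
    (colorClass G c j ⊓ surplusGraph G c₀).Reachable x y := by
  classical
  have hc := hc₀.reflTransGen h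
  by_cases hj : c s(x, y) = j
  · exact Adj.reachable ⟨⟨hs.1, hj⟩, c, h, hs⟩
  have hrec : Recolor G c (Function.update c s(x, y) j) := .update _ j hs
  have hadj : (colorClass G (Function.update c s(x, y) j) j).Adj x y := ⟨hs.1, by simp⟩
  obtain ⟨p, hp⟩ := (hc.reachable hrec hadj.reachable).exists_isPath
  have hpne : ∀ e ∈ p.edges, e ∈ G.edgeSet ∧ c e = j ∧ e ≠ s(x, y) := by
    intro e he
    have := p.edges_subset_edgeSet he
    induction e with
    | h a b => exact ⟨this.1, this.2, fun h => hj (h ▸ this.2)⟩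
  have hp' : ∀ e ∈ p.edges, e ∈ (colorClass G (Function.update c s(x, y) j) j).edgeSet := by
    intro e he
    obtain ⟨h1, h2, h3⟩ := hpne e he
    induction e with
    | h a b => exact ⟨h1, by rw [Function.update_of_ne h3, h2]⟩
  have hcyc : (Walk.cons hadj.symm (p.transfer _ hp')).IsCycle := by
    rw [Walk.cons_isCycle_iff]
    refine ⟨hp.transfer hp', fun hmem => ?_⟩
    rw [Walk.edges_transfer] at hmem
    exact (hpne _ hmem).2.2 Sym2.eq_swap
  refine ⟨p.transfer _ fun e he => ?_⟩
  have hmem : e ∈ (Walk.cons hadj.symm (p.transfer _ hp')).edges := by simp [he]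
  obtain ⟨h1, h2, h3⟩ := hpne e he
  have hsur : IsSurplus G (Function.update c s(x, y) j) e := by
    refine ⟨h1, fun hb => ?_⟩
    rw [Function.update_of_ne h3, h2] at hb
    exact hb.notMem_edges_of_isCycle hcyc hmem
  induction e with
  | h a b => exact ⟨⟨h1, h2⟩, _, h.tail hrec, hsur⟩

lemma reachable_inf_surplusGraph_of_reflTransGen (hc₀ : IsOptimalColoring G c₀)
    (h : Relation.ReflTransGen (Recolor G) c₀ c) (i : ι) {u v : W}
    (huv : (colorClass G c i ⊓ surplusGraph G c₀).Reachable u v) :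
    (colorClass G c₀ i ⊓ surplusGraph G c₀).Reachable u v := by
  classical
  induction h generalizing u v with
  | refl => exact huv
  | tail h hstep ih =>
    refine ih (huv.of_forall_adj fun a b hab => ?_)
    obtain ⟨e, j, he⟩ := hstep
    by_cases hae : s(a, b) = e
    · subst hae
      exact he.reachable hc₀ h i
    · refine Adj.reachable ⟨⟨hab.1.1, ?_⟩, hab.2⟩
      have := hab.1.2
      rwa [Function.update_of_ne hae] at this

lemma IsOptimalColoring.reachable_inf_surplusGraph (hc₀ : IsOptimalColoring G c₀) (i : ι) {u v : W}
    (huv : (surplusGraph G c₀).Reachable u v) :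
    (colorClass G c₀ i ⊓ surplusGraph G c₀).Reachable u v :=
  huv.of_forall_adj fun _ _ hab => by
    obtain ⟨_, h, hs⟩ := hab
    exact reachable_inf_surplusGraph_of_reflTransGen hc₀ h i (hs.reachable hc₀ h i)

end Fintype

section Count

variable [Fintype W] {G : SimpleGraph W} {c : Sym2 W → ι}

open Classical in
/-- The edges of `G` joining different components of the surplus graph. -/
noncomputable def crossingEdges (G : SimpleGraph W) (c : Sym2 W → ι) : Finset (Sym2 W) :=
  {e | e ∈ G.edgeSet ∧ ∀ x y, e = s(x, y) → ¬ (surplusGraph G c).Reachable x y}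

lemma mem_crossingEdges {x y : W} :
    s(x, y) ∈ crossingEdges G c ↔ G.Adj x y ∧ ¬ (surplusGraph G c).Reachable x y := by
  simp only [crossingEdges, Finset.mem_filter, Finset.mem_univ, true_and, mem_edgeSet]
  refine and_congr_right fun _ => ⟨fun h => h _ _ rfl, fun h a b hab => ?_⟩
  rcases Sym2.eq_iff.1 hab with ⟨rfl, rfl⟩ | ⟨rfl, rfl⟩
  · exact h
  · exact fun h' => h h'.symm

lemma IsOptimalColoring.card_crossingEdges_le [Fintype ι] [Nonempty W] (hc : IsOptimalColoring G c) :
    (crossingEdges G c).card + Fintype.card ι ≤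
      Fintype.card ι * Nat.card (surplusGraph G c).ConnectedComponent := by
  classical
  have key : ∀ i : ι, ((crossingEdges G c).filter (c · = i)).card + 1 ≤
      Nat.card (surplusGraph G c).ConnectedComponent := by
    intro i
    have h1 := card_add_card_connectedComponent_le (colorClass G c i)
      ((crossingEdges G c).filter (c · = i)) fun e he => by
        obtain ⟨he, hi⟩ := Finset.mem_filter.1 he
        induction e with
        | h x y =>
          rw [mem_crossingEdges] at he
          refine ⟨⟨he.1, hi⟩, by_contra fun hb => he.2 (Adj.reachable ?_)⟩
          exact ⟨c, .refl, he.1, by rwa [hi]⟩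
    have h2 : Nat.card ((colorClass G c i).deleteEdges
        ((crossingEdges G c).filter (c · = i) : Finset _)).ConnectedComponent ≤
        Nat.card (surplusGraph G c).ConnectedComponent := by
      refine card_connectedComponent_le fun u v huv => ?_
      refine (hc.reachable_inf_surplusGraph i huv).mono fun a b hab => ?_
      rw [deleteEdges_adj]
      refine ⟨hab.1, fun hmem => ?_⟩
      exact (mem_crossingEdges.1 (Finset.mem_filter.1 hmem).1).2 hab.2.reachable
    have h3 : 0 < Nat.card (colorClass G c i).ConnectedComponent := Nat.card_pos
    omega
  calc (crossingEdges G c).card + Fintype.card ι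
      = ∑ i : ι, (((crossingEdges G c).filter (c · = i)).card + 1) := by
        rw [Finset.sum_add_distrib,
          Finset.card_eq_sum_card_fiberwise (f := c) (t := Finset.univ) (fun _ _ => by simp)]
        simp
    _ ≤ ∑ _i : ι, Nat.card (surplusGraph G c).ConnectedComponent :=
        Finset.sum_le_sum fun i _ => key i
    _ = _ := by simp

open Classical in
lemma le_card_crossingEdges {m : ℕ}
    (hcut : ∀ U : Set W, U.Nonempty → Uᶜ.Nonempty →
      2 * m ≤ (Finset.univ.filter fun p : W × W => p.1 ∈ U ∧ p.2 ∉ U ∧ G.Adj p.1 p.2).card)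
    (hR : ¬ (surplusGraph G c).Preconnected) :
    m * Nat.card (surplusGraph G c).ConnectedComponent ≤ (crossingEdges G c).card := by
  set R := surplusGraph G c
  let A : Finset (W × W) := {p | G.Adj p.1 p.2 ∧ ¬ R.Reachable p.1 p.2}
  have hA : A.card ≤ 2 * (crossingEdges G c).card := by
    refine Finset.card_le_mul_card_image_of_maps_to (f := fun p => s(p.1, p.2))
      (fun p hp => mem_crossingEdges.2 (by simpa [A] using hp)) 2 fun e _ => ?_
    induction e with
    | h x y =>
      refine (Finset.card_le_card (t := {(x, y), (y, x)}) fun p hp => ?_).trans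
        Finset.card_le_two
      have := (Finset.mem_filter.1 hp).2
      rcases Sym2.eq_iff.1 this with ⟨h1, h2⟩ | ⟨h1, h2⟩
      · simp [← h1, ← h2]
      · simp [← h1, ← h2]
  have hK : ∀ K : R.ConnectedComponent,
      2 * m ≤ (A.filter fun p => R.connectedComponentMk p.1 = K).card := by
    intro K
    refine (hcut K.supp K.nonempty_supp ?_).trans (Finset.card_le_card fun p hp => ?_)
    · rw [Set.nonempty_compl]
      intro h
      refine hR fun a b => K.reachable_of_mem_supp ?_ ?_ <;> simp [h]
    · simp only [Finset.mem_filter, Finset.mem_univ, true_and, ConnectedComponent.mem_supp_iff,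
        A] at hp ⊢
      refine ⟨⟨hp.2.2, fun h => hp.2.1 ?_⟩, hp.1⟩
      rw [← hp.1]
      exact ConnectedComponent.sound h.symm
  have hsum : 2 * m * Nat.card R.ConnectedComponent ≤ A.card := by
    rw [Finset.card_eq_sum_card_fiberwise (f := fun p => R.connectedComponentMk p.1)
      (t := Finset.univ) (fun _ _ => by simp), Nat.card_eq_fintype_card, mul_comm,
      ← smul_eq_mul, ← Finset.card_univ, ← Finset.sum_const]
    exact Finset.sum_le_sum fun K _ => hK K
  nlinarith

end Count

open Classical in
/-- A graph whose edge cuts all have at least `2 * m` edges contains `m` edge-disjoint connected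
spanning subgraphs (Nash-Williams, Tutte). -/
theorem exists_edgeDisjoint_connected [Fintype W] [Nonempty W] (G : SimpleGraph W) (m : ℕ)
    (hcut : ∀ U : Set W, U.Nonempty → Uᶜ.Nonempty →
      2 * m ≤ (Finset.univ.filter fun p : W × W => p.1 ∈ U ∧ p.2 ∉ U ∧ G.Adj p.1 p.2).card) :
    ∃ T : Fin m → SimpleGraph W, (∀ i, T i ≤ G) ∧ (∀ i, (T i).Connected) ∧
      ∀ i j x y, (T i).Adj x y → (T j).Adj x y → i = j := by
  rcases Nat.eq_zero_or_pos m with rfl | hm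
  · exact ⟨Fin.elim0, Fin.rec0, Fin.rec0, Fin.rec0⟩
  have : Nonempty (Fin m) := ⟨⟨0, hm⟩⟩
  obtain ⟨c, hc⟩ : ∃ c : Sym2 W → Fin m, IsOptimalColoring G c :=
    ⟨_, fun c' => Function.argmin_le (colorPotential G) c'⟩
  have hR : (surplusGraph G c).Preconnected := by
    by_contra hR
    have h1 := hc.card_crossingEdges_le
    have h2 := le_card_crossingEdges hcut hR
    rw [Fintype.card_fin] at h1
    omega
  refine ⟨colorClass G c, fun i _ _ h => h.1, fun i => ⟨fun u v => ?_⟩, ?_⟩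
  · exact (hc.reachable_inf_surplusGraph i (hR u v)).mono inf_le_left
  · rintro i j x y ⟨-, rfl⟩ ⟨-, rfl⟩
    rfl

end Packing

end SimpleGraph

open Classical in
/-- Deleting a vertex from an `(n + 1)`-connected graph leaves a graph whose edge cuts have at
least `n` edges. -/
lemma IsKConnected.le_card_cut {V : Type*} [Fintype V] {G : SimpleGraph V} {n : ℕ}
    (hG : IsKConnected (n + 1) G) (v : V) (U : Set {w // w ≠ v}) (hU : U.Nonempty)
    (hUc : Uᶜ.Nonempty) :
    n ≤ (Finset.univ.filter fun p : {w // w ≠ v} × {w // w ≠ v} =>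
      p.1 ∈ U ∧ p.2 ∉ U ∧ (G.comap Subtype.val).Adj p.1 p.2).card := by
  set C := Finset.univ.filter fun p : {w // w ≠ v} × {w // w ≠ v} =>
      p.1 ∈ U ∧ p.2 ∉ U ∧ (G.comap Subtype.val).Adj p.1 p.2 with hC
  by_contra! hlt
  obtain ⟨x, hx, y, hy, hxy⟩ : ∃ x ∈ U, ∃ y ∉ U, ¬ G.Adj x.1 y.1 := by
    by_contra! hall
    have hsub : U.toFinset ×ˢ Uᶜ.toFinset ⊆ C := by
      intro p hp
      simp only [Finset.mem_product, Set.mem_toFinset, Set.mem_compl_iff] at hp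
      simpa [hC] using ⟨hp.1, hp.2, hall _ hp.1 _ hp.2⟩
    have h1 := Finset.card_le_card hsub
    rw [Finset.card_product] at h1
    have h2 : U.toFinset.card + Uᶜ.toFinset.card = Fintype.card V - 1 := by
      rw [Set.toFinset_compl, Finset.card_add_card_compl]
      simp
    have h3 : 0 < U.toFinset.card := Finset.card_pos.2 (by simpa using hU)
    have h4 : 0 < Uᶜ.toFinset.card := Finset.card_pos.2 (by simpa only [Set.toFinset_nonempty])
    have h5 := hG.1
    have h6 : n + 1 ≤ U.toFinset.card + Uᶜ.toFinset.card := by omega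
    nlinarith
  let f : {w // w ≠ v} × {w // w ≠ v} → V := fun p => if p.1 = x then p.2 else p.1
  let S : Finset V := insert v (C.image f)
  have hS : S.card < n + 1 :=
    (Finset.card_insert_le _ _).trans_lt (by have := Finset.card_image_le (s := C) (f := f); omega)
  have hmem : ∀ p ∈ C, p.1 ∈ U ∧ p.2 ∉ U ∧ G.Adj p.1 p.2 := by
    intro p hp
    simpa [hC] using hp
  have hxS : x.1 ∉ S := by
    simp only [S, Finset.mem_insert, Finset.mem_image, not_or, not_exists, not_and]
    refine ⟨x.2, fun p hp hf => ?_⟩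
    obtain ⟨h1, h2, h3⟩ := hmem p hp
    simp only [f] at hf
    split_ifs at hf with h
    · exact h2 (Subtype.ext hf ▸ hx)
    · exact h (Subtype.ext hf)
  have hyS : y.1 ∉ S := by
    simp only [S, Finset.mem_insert, Finset.mem_image, not_or, not_exists, not_and]
    refine ⟨y.2, fun p hp hf => ?_⟩
    obtain ⟨h1, h2, h3⟩ := hmem p hp
    simp only [f] at hf
    split_ifs at hf with h
    · exact hxy (h ▸ hf ▸ h3)
    · exact hy (Subtype.ext hf ▸ h1)
  obtain ⟨p⟩ := (hG.2 S hS).preconnected ⟨x.1, by simpa using hxS⟩ ⟨y.1, by simpa using hyS⟩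
  have key : ∀ (a b : ((S : Set V)ᶜ : Set V)), (G.induce ((S : Set V)ᶜ)).Walk a b →
      (∃ h : a.1 ≠ v, (⟨a.1, h⟩ : {w // w ≠ v}) ∈ U) →
      ∃ h : b.1 ≠ v, (⟨b.1, h⟩ : {w // w ≠ v}) ∈ U := by
    intro a b q
    induction q with
    | nil => exact id
    | @cons a b _ hab _ ih =>
      rintro ⟨ha, haU⟩
      have hbv : b.1 ≠ v := fun h => b.2 (by simp [S, h])
      refine ih ⟨hbv, by_contra fun hbU => ?_⟩
      have hpC : ((⟨a.1, ha⟩, ⟨b.1, hbv⟩) : {w // w ≠ v} × {w // w ≠ v}) ∈ C := by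
        simpa [hC] using ⟨haU, hbU, hab⟩
      have hfS : f (⟨a.1, ha⟩, ⟨b.1, hbv⟩) ∈ S :=
        Finset.mem_insert_of_mem (Finset.mem_image_of_mem f hpC)
      simp only [f] at hfS
      split_ifs at hfS
      · exact b.2 hfS
      · exact a.2 hfS
  obtain ⟨_, h⟩ := key _ _ p ⟨x.2, hx⟩
  exact hy h

lemma IsKConnected.le_degree {V : Type*} [Fintype V] {G : SimpleGraph V} [DecidableRel G.Adj]
    {n : ℕ} (hG : IsKConnected n G) (v : V) : n ≤ G.degree v := by
  classical
  by_contra! hlt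
  have hconn := hG.2 (G.neighborFinset v) hlt
  obtain ⟨w, hw⟩ : ∃ w, w ∉ insert v (G.neighborFinset v) := by
    by_contra! h
    have h1 := Finset.card_insert_le v (G.neighborFinset v)
    rw [Finset.eq_univ_iff_forall.2 h, Finset.card_univ, G.card_neighborFinset_eq_degree] at h1
    have := hG.1
    omega
  simp only [Finset.mem_insert, not_or] at hw
  let a : ((G.neighborFinset v : Set V)ᶜ : Set V) := ⟨v, by simp⟩
  let b : ((G.neighborFinset v : Set V)ᶜ : Set V) := ⟨w, by simpa using hw.2⟩
  have : Nontrivial ((G.neighborFinset v : Set V)ᶜ : Set V) :=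
    ⟨a, b, fun h => hw.1 (congrArg Subtype.val h).symm⟩
  obtain ⟨u, hu⟩ := hconn.preconnected.exists_adj_of_nontrivial a
  exact u.2 (by simpa [a] using hu)

lemma HasCliqueMinor.of_fintype {W ι : Type*} [Fintype ι] {H : SimpleGraph W} (B : ι → Set W)
    (hne : ∀ i, (B i).Nonempty) (hdisj : Pairwise fun i j => Disjoint (B i) (B j))
    (hconn : ∀ i, (H.induce (B i)).Connected)
    (hadj : Pairwise fun i j => ∃ u ∈ B i, ∃ v ∈ B j, H.Adj u v) :
    HasCliqueMinor H (Fintype.card ι) := by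
  let e := (Fintype.equivFin ι).symm
  exact ⟨B ∘ e, fun i => hne _, fun i j hij => hdisj (e.injective.ne hij), fun i => hconn _,
    fun i j hij => hadj (e.injective.ne hij)⟩

lemma HasCliqueMinor.le_hadwigerNumber {W : Type*} [Finite W] {H : SimpleGraph W} {t : ℕ}
    (h : HasCliqueMinor H t) : t ≤ hadwigerNumber H := by
  refine le_csSup ⟨Nat.card W, ?_⟩ h
  rintro s ⟨B, hne, hdisj, -, -⟩
  choose f hf using hne
  have hinj : Function.Injective f := fun i j hij =>
    by_contra fun h => Set.disjoint_left.1 (hdisj h) (hf i) (hij ▸ hf j)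
  simpa using Nat.card_le_card_of_injective f hinj

section TotalGraph

variable {V : Type*} {G : SimpleGraph V}

@[simp] lemma totalGraph_adj_inl_inl {u v : V} :
    (totalGraph G).Adj (Sum.inl u) (Sum.inl v) ↔ G.Adj u v := by
  simp only [totalGraph, fromRel_adj, ne_eq, Sum.inl.injEq]
  exact ⟨fun h => h.2.elim id fun h => h.symm, fun h => ⟨h.ne, .inl h⟩⟩

@[simp] lemma totalGraph_adj_inl_inr {u : V} {e : G.edgeSet} :
    (totalGraph G).Adj (Sum.inl u) (Sum.inr e) ↔ u ∈ (e : Sym2 V) := by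
  simp [totalGraph]

@[simp] lemma totalGraph_adj_inr_inl {u : V} {e : G.edgeSet} :
    (totalGraph G).Adj (Sum.inr e) (Sum.inl u) ↔ u ∈ (e : Sym2 V) := by
  simp [totalGraph]

@[simp] lemma totalGraph_adj_inr_inr {e f : G.edgeSet} :
    (totalGraph G).Adj (Sum.inr e) (Sum.inr f) ↔
      e ≠ f ∧ ∃ u, u ∈ (e : Sym2 V) ∧ u ∈ (f : Sym2 V) := by
  simp only [totalGraph, fromRel_adj, ne_eq, Sum.inr.injEq]
  exact and_congr_right fun _ => ⟨fun h => h.elim id fun ⟨u, h, h'⟩ => ⟨u, h', h⟩, .inl⟩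

/-- Total colorings of `G` are colorings of its total graph. -/
lemma IsTotalColoring.colorable {cv : V → ℕ} {ce : Sym2 V → ℕ} (h : IsTotalColoring G cv ce)
    {n : ℕ} (hv : ∀ v, cv v < n) (he : ∀ e ∈ G.edgeSet, ce e < n) :
    (totalGraph G).Colorable n := by
  refine ⟨Coloring.mk (Sum.elim (fun v => ⟨cv v, hv v⟩) fun e => ⟨ce e, he e e.2⟩) ?_⟩
  have hve : ∀ (u : V) (e : G.edgeSet), u ∈ (e : Sym2 V) → ce e ≠ cv u := by
    rintro u ⟨e, heG⟩ hu
    obtain ⟨w, rfl⟩ := hu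
    exact (h.2.2 heG).1
  rintro (u | e) (v | f) hadj
  · rw [totalGraph_adj_inl_inl] at hadj
    simpa using h.1 hadj
  · rw [totalGraph_adj_inl_inr] at hadj
    simpa using (hve u f hadj).symm
  · rw [totalGraph_adj_inr_inl] at hadj
    simpa using hve v e hadj
  · rw [totalGraph_adj_inr_inr] at hadj
    obtain ⟨hne, u, hu, hu'⟩ := hadj
    obtain ⟨e, heG⟩ := e
    obtain ⟨f, hfG⟩ := f
    obtain ⟨a, rfl⟩ := hu
    obtain ⟨b, rfl⟩ := hu'
    simpa using h.2.1 heG hfG fun hab => hne (by subst hab; rfl)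

lemma chromaticNumber_totalGraph_le [Finite V] (G : SimpleGraph V) :
    (totalGraph G).chromaticNumber ≤ totalChromaticNumber G := by
  have hne : {k | ∃ cv ce, IsTotalColoring G cv ce ∧ (∀ v, cv v < k) ∧
      ∀ e ∈ G.edgeSet, ce e < k}.Nonempty := by
    let g := Finite.equivFin (V ⊕ Sym2 V)
    have hg : ∀ {x y}, x ≠ y → (g x : ℕ) ≠ g y := fun h h' => h (g.injective (Fin.ext h'))
    refine ⟨Nat.card (V ⊕ Sym2 V), fun v => g (.inl v), fun e => g (.inr e), ⟨?_, ?_, ?_⟩,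
      fun v => (g _).2, fun e _ => (g _).2⟩
    · exact fun u v huv => hg (by simpa using huv.ne)
    · exact fun u v w _ _ hvw => hg fun h => hvw (Sym2.congr_right.1 (Sum.inr.inj h))
    · exact fun u v _ => ⟨hg (by simp), hg (by simp)⟩
  obtain ⟨cv, ce, h, hv, he⟩ := Nat.sInf_mem hne
  exact (h.colorable hv he).chromaticNumber_le

/-- The set of vertices of the total graph of `G` formed by the vertex `w` and the edges of `T`. -/
def branchSet (G : SimpleGraph V) {v : V} (T : SimpleGraph {w // w ≠ v}) (w : V) :
    Set (V ⊕ G.edgeSet) :=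
  {x | x = Sum.inl w ∨
    ∃ a b, T.Adj a b ∧ ∃ h : s(a.1, b.1) ∈ G.edgeSet, x = Sum.inr ⟨s(a.1, b.1), h⟩}

lemma inr_mem_branchSet {v w : V} {T : SimpleGraph {w // w ≠ v}}
    (hTG : T ≤ G.comap Subtype.val) {a b : {w // w ≠ v}} (hab : T.Adj a b) :
    (Sum.inr ⟨s(a.1, b.1), hTG hab⟩ : V ⊕ G.edgeSet) ∈ branchSet G T w :=
  .inr ⟨a, b, hab, hTG hab, rfl⟩

lemma connected_induce_branchSet {v : V} {T : SimpleGraph {w // w ≠ v}}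
    (hTG : T ≤ G.comap Subtype.val) (hT : T.Connected) (w : {w // w ≠ v}) :
    ((totalGraph G).induce (branchSet G T w)).Connected := by
  have key : ∀ (a c : {w // w ≠ v}) (_ : T.Walk a c) (b) (hab : T.Adj a b),
      ((totalGraph G).induce (branchSet G T c)).Reachable ⟨_, .inl rfl⟩
        ⟨_, inr_mem_branchSet hTG hab⟩ := by
    intro a c p
    induction p with
    | nil => exact fun b hab => Adj.reachable (by simp)
    | @cons a d c had _ ih =>
      intro b hab
      refine (ih a had.symm).trans ?_
      by_cases h : s(a.1, b.1) = s(d.1, a.1)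
      · simp only [h]
        rfl
      · refine Adj.reachable ?_
        rw [induce_adj, totalGraph_adj_inr_inr]
        exact ⟨fun h' => h (congrArg Subtype.val h').symm, a, by simp, by simp⟩
  rw [connected_iff_exists_forall_reachable]
  refine ⟨⟨_, .inl rfl⟩, ?_⟩
  rintro ⟨x, rfl | ⟨a, b, hab, h, rfl⟩⟩
  · rfl
  · exact key a w (hT.preconnected a w).some b hab

/-- A vertex `v`, its incident edges, and `m` edge-disjoint connected spanning subgraphs of `G - v`
give a clique minor in the total graph. -/
lemma hasCliqueMinor_totalGraph [Fintype V] [DecidableRel G.Adj] (v : V) (m : ℕ)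
    (hm : m ≤ G.degree v) (T : Fin m → SimpleGraph {w // w ≠ v})
    (hTG : ∀ i, T i ≤ G.comap Subtype.val) (hT : ∀ i, (T i).Connected)
    (hdisj : ∀ i j x y, (T i).Adj x y → (T j).Adj x y → i = j)
    (hnt : Fin m → Nontrivial {w // w ≠ v}) :
    HasCliqueMinor (totalGraph G) (G.degree v + 1 + m) := by
  classical
  obtain ⟨w⟩ : Nonempty (Fin m ↪ G.neighborSet v) :=
    Function.Embedding.nonempty_of_card_le (by simpa [G.card_neighborSet_eq_degree] using hm)
  have hwv : ∀ i, (w i).1 ≠ v := fun i => (w i).2.ne'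
  have hinc : ∀ i a, ∃ b, (T i).Adj a b := fun i a =>
    have := hnt i
    (hT i).preconnected.exists_adj_of_nontrivial a
  have hnot : ∀ i, ∀ e : G.edgeSet, v ∈ (e : Sym2 V) →
      Sum.inr e ∉ branchSet G (T i) (w i).1 := by
    rintro i e hv (h | ⟨a, b, -, h, he⟩)
    · simp at h
    · obtain rfl := Sum.inr.inj he
      rcases Sym2.mem_iff.1 hv with h | h
      · exact a.2 h.symm
      · exact b.2 h.symm
  let B : Option (G.neighborSet v) ⊕ Fin m → Set (V ⊕ G.edgeSet)
    | .inl none => {Sum.inl v}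
    | .inl (some u) => {Sum.inr ⟨s(v, u.1), u.2⟩}
    | .inr i => branchSet G (T i) (w i).1
  have hedge : ∀ {u u' : G.neighborSet v}, u ≠ u' → s(v, u.1) ≠ s(v, u'.1) := fun h h' =>
    h (Subtype.ext (Sym2.congr_right.1 h'))
  have hcard : Fintype.card (Option (G.neighborSet v) ⊕ Fin m) = G.degree v + 1 + m := by
    simp [G.card_neighborSet_eq_degree]
  rw [← hcard]
  refine HasCliqueMinor.of_fintype B ?_ ?_ ?_ ?_
  · rintro ((_ | u) | i)
    · exact Set.singleton_nonempty _
    · exact Set.singleton_nonempty _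
    · exact ⟨_, .inl rfl⟩
  · have hv : ∀ i, Disjoint {Sum.inl v} (branchSet G (T i) (w i).1) := by
      intro i
      rw [Set.disjoint_singleton_left]
      rintro (h | ⟨a, b, -, h, he⟩)
      · exact hwv i (Sum.inl.inj h).symm
      · simp at he
    have hu : ∀ (u : G.neighborSet v) i,
        Disjoint {Sum.inr ⟨s(v, u.1), u.2⟩} (branchSet G (T i) (w i).1) := by
      intro u i
      rw [Set.disjoint_singleton_left]
      exact hnot i _ (by simp)
    rintro ((_ | u) | i) ((_ | u') | j) hij
    · exact absurd rfl hij
    · simp [B]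
    · exact hv j
    · simp [B]
    · have : u ≠ u' := fun h => hij (by rw [h])
      exact Set.disjoint_singleton.2 fun h =>
        hedge this (congrArg Subtype.val (Sum.inr.inj h))
    · exact hu u j
    · exact (hv i).symm
    · exact (hu u' i).symm
    · have hij' : i ≠ j := fun h => hij (by rw [h])
      refine Set.disjoint_left.2 ?_
      rintro x (rfl | ⟨a, b, hab, h, rfl⟩) (h' | ⟨a', b', hab', h', he⟩)
      · exact hij' (w.injective (Subtype.ext (Sum.inl.inj h')))
      · simp at he
      · simp at h'
      · have he : s(a.1, b.1) = s(a'.1, b'.1) := congrArg Subtype.val (Sum.inr.inj he)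
        rcases Sym2.eq_iff.1 he with ⟨h1, h2⟩ | ⟨h1, h2⟩
        · obtain rfl := Subtype.ext h1
          obtain rfl := Subtype.ext h2
          exact hij' (hdisj _ _ _ _ hab hab')
        · obtain rfl := Subtype.ext h1
          obtain rfl := Subtype.ext h2
          exact hij' (hdisj _ _ _ _ hab hab'.symm)
  · rintro ((_ | u) | i)
    · simp only [B]
      exact Connected.of_subsingleton
    · simp only [B]
      exact Connected.of_subsingleton
    · exact connected_induce_branchSet (hTG i) (hT i) ⟨_, hwv i⟩
  · have hsymm : ∀ i j, (∃ x ∈ B i, ∃ y ∈ B j, (totalGraph G).Adj x y) →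
        ∃ x ∈ B j, ∃ y ∈ B i, (totalGraph G).Adj x y :=
      fun _ _ ⟨x, hx, y, hy, h⟩ => ⟨y, hy, x, hx, h.symm⟩
    have hvu : ∀ u, ∃ x ∈ B (.inl none), ∃ y ∈ B (.inl (some u)), (totalGraph G).Adj x y :=
      fun u => ⟨_, rfl, _, rfl, by simp⟩
    have hvi : ∀ i, ∃ x ∈ B (.inl none), ∃ y ∈ B (.inr i), (totalGraph G).Adj x y :=
      fun i => ⟨_, rfl, _, .inl rfl, totalGraph_adj_inl_inl.2 (w i).2⟩
    have hui : ∀ u i, ∃ x ∈ B (.inl (some u)), ∃ y ∈ B (.inr i), (totalGraph G).Adj x y := by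
      intro u i
      obtain ⟨b, hb⟩ := hinc i ⟨u.1, u.2.ne'⟩
      refine ⟨_, rfl, _, inr_mem_branchSet (hTG i) hb, ?_⟩
      rw [totalGraph_adj_inr_inr]
      exact ⟨fun h => hnot i _ (by simp) (h ▸ inr_mem_branchSet (hTG i) hb),
        u.1, by simp, by simp⟩
    rintro ((_ | u) | i) ((_ | u') | j) hij
    · exact absurd rfl hij
    · exact hvu _
    · exact hvi _
    · exact hsymm (.inl none) (.inl (some u)) (hvu u)
    · have : u ≠ u' := fun h => hij (by rw [h])
      refine ⟨_, rfl, _, rfl, ?_⟩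
      rw [totalGraph_adj_inr_inr]
      exact ⟨fun h => hedge this (congrArg Subtype.val h), v, by simp, by simp⟩
    · exact hui _ _
    · exact hsymm (.inl none) (.inr i) (hvi i)
    · exact hsymm (.inl (some u')) (.inr i) (hui u' i)
    · have := hnt i
      obtain ⟨a⟩ : Nonempty {w // w ≠ v} := inferInstance
      obtain ⟨b, hb⟩ := hinc i a
      obtain ⟨c, hc⟩ := hinc j a
      refine ⟨_, inr_mem_branchSet (hTG i) hb, _, inr_mem_branchSet (hTG j) hc, ?_⟩
      rw [totalGraph_adj_inr_inr]
      refine ⟨fun h => hij ?_, a.1, by simp, by simp⟩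
      obtain rfl := Subtype.ext (Sym2.congr_right.1 (congrArg Subtype.val h))
      rw [hdisj _ _ _ _ hb hc]

end TotalGraph

/-- if `k ≥ 1` and `G` is a `(2k-1)`-vertex-connected simple finite graph
with `χ''(G) ≤ Δ(G) + k`, then Hadwiger's conjecture holds for `T(G)`:
`χ(T(G)) ≤ η(T(G))`. -/
theorem hadwiger_totalGraph_of_connectivity {V : Type*} [Fintype V] (G : SimpleGraph V)
    [DecidableRel G.Adj] (k : ℕ) (hk : 1 ≤ k) (hconn : IsKConnected (2 * k - 1) G)
    (htcc : totalChromaticNumber G ≤ G.maxDegree + k) :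
    (totalGraph G).chromaticNumber ≤ (hadwigerNumber (totalGraph G) : ℕ∞) := by
  classical
  obtain ⟨m, rfl⟩ : ∃ m, k = m + 1 := ⟨k - 1, by omega⟩
  rw [show 2 * (m + 1) - 1 = 2 * m + 1 by omega] at hconn
  have hV := hconn.1
  have : Nonempty V := Fintype.card_pos_iff.1 (by omega)
  obtain ⟨v, hv⟩ := G.exists_maximal_degree_vertex
  have hcard : Fintype.card {w // w ≠ v} = Fintype.card V - 1 := by simp
  have hne : Nonempty {w // w ≠ v} := Fintype.card_pos_iff.1 (by omega)
  obtain ⟨T, hTG, hT, hdisj⟩ := exists_edgeDisjoint_connected (G.comap Subtype.val) m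
    (hconn.le_card_cut v)
  have hdeg := hconn.le_degree v
  have hminor := hasCliqueMinor_totalGraph v m (by omega) T hTG hT hdisj fun i =>
    Fintype.one_lt_card_iff_nontrivial.1 (by have := i.2; omega)
  refine (chromaticNumber_totalGraph_le G).trans (Nat.cast_le.2 ?_)
  have := hminor.le_hadwigerNumber
  omega
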